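/- Let L ≥ 1 and u_l < u_h be reals. Then the shift-domain beamforming matrix A ∈ ℂ^{L×L} associated with u_l, u_h is Hermitian and positive semidefinite. -/

import Mathlib

open Complex

/-- The shift-domain beamforming matrix `A` associated with `u_l < u_h`. -/
noncomputable def bfMatrix (L : ℕ) (ul uh : ℝ) : Matrix (Fin L) (Fin L) ℂ :=
  Matrix.of fun m m' =>
    if m = m' then ((uh - ul : ℝ) : ℂ)
    else (Complex.exp (Complex.I * (((m : ℕ) : ℂ) - ((m' : ℕ) : ℂ)) * (uh : ℂ)) -
          Complex.exp (Complex.I * (((m : ℕ) : ℂ) - ((m' : ℕ) : ℂ)) * (ul : ℂ))) /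
      (Complex.I * (((m : ℕ) : ℂ) - ((m' : ℕ) : ℂ)))

/-- The entries of `bfMatrix` are integrals of complex exponentials. -/
theorem bfMatrix_apply_eq_integral (L : ℕ) (ul uh : ℝ) (m m' : Fin L) :
    bfMatrix L ul uh m m' =
      ∫ x in ul..uh, Complex.exp (Complex.I * (((m : ℕ) : ℂ) - ((m' : ℕ) : ℂ)) * (x : ℂ)) := by
  by_cases h : m = m'
  · subst h
    simp [bfMatrix]
  · have hc : Complex.I * (((m : ℕ) : ℂ) - ((m' : ℕ) : ℂ)) ≠ 0 := by
      refine mul_ne_zero Complex.I_ne_zero (sub_ne_zero.mpr fun h' => h (Fin.ext ?_))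
      exact_mod_cast h'
    rw [integral_exp_mul_complex hc]
    simp [bfMatrix, h]

theorem bfMatrix_isHermitian (L : ℕ) (ul uh : ℝ) : (bfMatrix L ul uh).IsHermitian := by
  refine Matrix.IsHermitian.ext fun m m' => ?_
  rw [bfMatrix_apply_eq_integral, bfMatrix_apply_eq_integral, ← starRingEnd_apply,
    ← intervalIntegral.intervalIntegral_conj]
  refine intervalIntegral.integral_congr fun x _ => ?_
  simp only [← Complex.exp_conj, map_mul, map_sub, Complex.conj_I, Complex.conj_ofReal, map_natCast]
  congr 1
  ring

/-- The quadratic form of `bfMatrix` is the energy of a trigonometric polynomial. -/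
theorem bfMatrix_quadraticForm_eq_integral (L : ℕ) (ul uh : ℝ) (w : Fin L → ℂ) :
    ∑ m : Fin L, ∑ m' : Fin L, (starRingEnd ℂ) (w m) * bfMatrix L ul uh m m' * w m' =
      ((∫ x in ul..uh, Complex.normSq
        (∑ m : Fin L, Complex.exp (-(Complex.I * ((m : ℕ) : ℂ) * (x : ℂ))) * w m) : ℝ) : ℂ) := by
  simp_rw [bfMatrix_apply_eq_integral, ← intervalIntegral.integral_const_mul,
    ← intervalIntegral.integral_mul_const]
  rw [← intervalIntegral.integral_ofReal]
  simp_rw [Complex.normSq_eq_conj_mul_self, map_sum, Finset.sum_mul_sum]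
  rw [intervalIntegral.integral_finsetSum
    fun m _ => Continuous.intervalIntegrable (by fun_prop) _ _]
  refine Finset.sum_congr rfl fun m _ => ?_
  rw [intervalIntegral.integral_finsetSum
    fun m' _ => Continuous.intervalIntegrable (by fun_prop) _ _]
  refine Finset.sum_congr rfl fun m' _ => intervalIntegral.integral_congr fun x _ => ?_
  have hexp : Complex.exp (Complex.I * (((m : ℕ) : ℂ) - ((m' : ℕ) : ℂ)) * (x : ℂ)) =
      Complex.exp (Complex.I * ((m : ℕ) : ℂ) * (x : ℂ)) *
        Complex.exp (-(Complex.I * ((m' : ℕ) : ℂ) * (x : ℂ))) := by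
    rw [← Complex.exp_add]
    congr 1
    ring
  simp only [hexp, map_mul, ← Complex.exp_conj, map_neg, Complex.conj_I, Complex.conj_ofReal,
    map_natCast, neg_mul, neg_neg]
  ring

/-- The shift-domain beamforming matrix is Hermitian and positive semidefinite. -/
theorem bfMatrix_hermitian_psd (L : ℕ) (hL : 1 ≤ L) (ul uh : ℝ) (hu : ul < uh) :
    (bfMatrix L ul uh).IsHermitian ∧
      ∀ w : Fin L → ℂ,
        0 ≤ (∑ m : Fin L, ∑ m' : Fin L,
          (starRingEnd ℂ) (w m) * bfMatrix L ul uh m m' * w m').re := by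
  refine ⟨bfMatrix_isHermitian L ul uh, fun w => ?_⟩
  rw [bfMatrix_quadraticForm_eq_integral, Complex.ofReal_re]
  exact intervalIntegral.integral_nonneg hu.le fun x _ => Complex.normSq_nonneg _
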